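/- (Regularity of the MPI forward operator) Let β, μ₀, m₀ > 0, let G be an invertible real 3×3 matrix, let I ⊂ ℝ be a compact interval with positive length, let Ω ⊂ ℝ³ be a bounded Lebesgue-measurable set with positive Lebesgue measure, let R₁, R₂, R₃ ∈ ℝ³ span ℝ³, let x_s : I → ℝ³ be continuously differentiable, and assume there exists an interior point t* of I with ẋ_s(t*) ≠ 0. Define u : I → ℝ³ componentwise by u_i(t) = −μ₀ m₀ ∫_Ω R_iᵀ F̃(G(x − x_s(t))) G ẋ_s(t) dx (with F̃ extended to ξ = 0 by (β/3)·I₃). Then ∫_I ‖u(t)‖² dt > 0; in particular u is not identically zero. -/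

import Mathlib

open MeasureTheory Filter Matrix
open scoped Topology

/-- The hyperbolic cotangent `coth y = cosh y / sinh y`. -/
noncomputable def coth (y : ℝ) : ℝ := Real.cosh y / Real.sinh y

/-- The dilated Langevin function `L_β`: `L_β z = coth (β z) - 1/(β z)` for `z ≠ 0`, `L_β 0 = 0`. -/
noncomputable def Lb (β z : ℝ) : ℝ := if z = 0 then 0 else coth (β * z) - 1 / (β * z)

/-- `L'_β z = 1/(β z²) - β/(sinh (β z))²` (the derivative of `L_β` away from `0`). -/
noncomputable def Lb' (β z : ℝ) : ℝ := 1 / (β * z ^ 2) - β / (Real.sinh (β * z)) ^ 2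

/-- The Euclidean norm on `ℝ³`. -/
noncomputable def enorm3 (ξ : Fin 3 → ℝ) : ℝ := Real.sqrt (∑ i, ξ i ^ 2)

/-- The matrix `F̃(ξ) = (L'_β(‖ξ‖)/‖ξ‖² − L_β(‖ξ‖)/‖ξ‖³)·ξξᵀ + (L_β(‖ξ‖)/‖ξ‖)·I₃` for `ξ ≠ 0`,
extended to `ξ = 0` by `(β/3)·I₃`. -/
noncomputable def Ftilde (β : ℝ) (ξ : Fin 3 → ℝ) : Matrix (Fin 3) (Fin 3) ℝ :=
  if ξ = 0 then (β / 3) • (1 : Matrix (Fin 3) (Fin 3) ℝ)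
  else (Lb' β (enorm3 ξ) / (enorm3 ξ) ^ 2 - Lb β (enorm3 ξ) / (enorm3 ξ) ^ 3) •
        Matrix.of (fun i j => ξ i * ξ j)
      + (Lb β (enorm3 ξ) / enorm3 ξ) • (1 : Matrix (Fin 3) (Fin 3) ℝ)

open Real in
theorem sinh_lt_self_mul_cosh {s : ℝ} (hs : 0 < s) : sinh s < s * cosh s := by
  have hmono : StrictMonoOn (fun y => y * cosh y - sinh y) (Set.Ici 0) := by
    refine strictMonoOn_of_deriv_pos (convex_Ici 0) (by fun_prop) fun y hy => ?_
    rw [interior_Ici] at hy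
    have h : HasDerivAt (fun y => y * cosh y - sinh y) (1 * cosh y + y * sinh y - cosh y) y :=
      ((hasDerivAt_id y).mul (hasDerivAt_cosh y)).sub (hasDerivAt_sinh y)
    rw [h.deriv]
    have := mul_pos hy (sinh_pos_iff.2 hy)
    linarith
  have := hmono Set.self_mem_Ici hs.le hs
  simp only [zero_mul, sinh_zero, sub_zero] at this
  linarith

open Real in
theorem self_mul_cosh_sub_sinh_le {s : ℝ} (hs : 0 < s) :
    s * cosh s - sinh s ≤ s ^ 2 * sinh s := by
  have h2 : s = 2 * (s / 2) := by ring
  have hcosh : cosh s - 1 = 2 * sinh (s / 2) ^ 2 := by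
    rw [h2, cosh_two_mul, cosh_sq, ← h2]; ring
  have hsinh : sinh s = 2 * sinh (s / 2) * cosh (s / 2) := by
    conv_lhs => rw [h2, sinh_two_mul]
  have hpos : 0 < sinh (s / 2) := sinh_pos_iff.2 (by positivity)
  have hlt := sinh_lt_self_mul_cosh (half_pos hs)
  have hle : cosh s - 1 ≤ s * sinh s := by
    rw [hcosh, hsinh]
    nlinarith [mul_pos hpos hpos, mul_pos hpos (sub_pos.2 hlt)]
  nlinarith [self_lt_sinh_iff.2 hs]

theorem Lb'_eq {β r : ℝ} (hβ : 0 < β) (hr : 0 < r) :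
    Lb' β r = β * (1 / (β * r) ^ 2 - 1 / Real.sinh (β * r) ^ 2) := by
  unfold Lb'; field_simp

theorem Lb'_pos {β r : ℝ} (hβ : 0 < β) (hr : 0 < r) : 0 < Lb' β r := by
  rw [Lb'_eq hβ hr]
  have hs : 0 < β * r := mul_pos hβ hr
  have h := Real.self_lt_sinh_iff.2 hs
  exact mul_pos hβ (sub_pos.2 (one_div_lt_one_div_of_lt (by positivity) (by gcongr)))

theorem Lb'_le {β r : ℝ} (hβ : 0 < β) (hr : 0 < r) : Lb' β r ≤ β := by
  rw [Lb'_eq hβ hr]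
  have hs : 0 < β * r := mul_pos hβ hr
  have hsinh : 0 < Real.sinh (β * r) := Real.sinh_pos_iff.2 hs
  have hlt := sinh_lt_self_mul_cosh hs
  refine mul_le_of_le_one_right hβ.le ?_
  rw [div_sub_div _ _ (by positivity) (by positivity), div_le_one (by positivity)]
  have h : Real.sinh (β * r) ^ 2 ≤ (β * r * Real.cosh (β * r)) ^ 2 := by gcongr
  rw [mul_pow, Real.cosh_sq] at h
  linarith

theorem Lb_div_eq {β r : ℝ} (hβ : 0 < β) (hr : 0 < r) :
    Lb β r / r = β * ((β * r * Real.cosh (β * r) - Real.sinh (β * r)) /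
      ((β * r) ^ 2 * Real.sinh (β * r))) := by
  have hsinh : 0 < Real.sinh (β * r) := Real.sinh_pos_iff.2 (mul_pos hβ hr)
  rw [Lb, if_neg hr.ne', coth]; field_simp

theorem Lb_div_pos {β r : ℝ} (hβ : 0 < β) (hr : 0 < r) : 0 < Lb β r / r := by
  rw [Lb_div_eq hβ hr]
  have hs : 0 < β * r := mul_pos hβ hr
  have hsinh : 0 < Real.sinh (β * r) := Real.sinh_pos_iff.2 hs
  exact mul_pos hβ (div_pos (sub_pos.2 (sinh_lt_self_mul_cosh hs)) (by positivity))

theorem Lb_div_le {β r : ℝ} (hβ : 0 < β) (hr : 0 < r) : Lb β r / r ≤ β := by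
  rw [Lb_div_eq hβ hr]
  have hs : 0 < β * r := mul_pos hβ hr
  have hsinh : 0 < Real.sinh (β * r) := Real.sinh_pos_iff.2 hs
  exact mul_le_of_le_one_right hβ.le
    ((div_le_one (by positivity)).2 (self_mul_cosh_sub_sinh_le hs))

theorem enorm3_sq (ξ : Fin 3 → ℝ) : enorm3 ξ ^ 2 = ∑ i, ξ i ^ 2 :=
  Real.sq_sqrt (Finset.sum_nonneg fun _ _ => sq_nonneg _)

theorem enorm3_pos {ξ : Fin 3 → ℝ} (hξ : ξ ≠ 0) : 0 < enorm3 ξ := by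
  obtain ⟨i, hi⟩ := Function.ne_iff.1 hξ
  exact Real.sqrt_pos.2 (Finset.sum_pos' (fun _ _ => sq_nonneg _)
    ⟨i, Finset.mem_univ i, sq_pos_of_ne_zero hi⟩)

theorem Ftilde_apply (β : ℝ) {ξ : Fin 3 → ℝ} (hξ : ξ ≠ 0) (i j : Fin 3) :
    Ftilde β ξ i j = (Lb' β (enorm3 ξ) - Lb β (enorm3 ξ) / enorm3 ξ) *
      (ξ i * ξ j / enorm3 ξ ^ 2) +
      Lb β (enorm3 ξ) / enorm3 ξ * (1 : Matrix (Fin 3) (Fin 3) ℝ) i j := by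
  have := enorm3_pos hξ
  simp only [Ftilde, if_neg hξ, Matrix.add_apply, Matrix.smul_apply, Matrix.of_apply, smul_eq_mul]
  field_simp

theorem dotProduct_Ftilde_mulVec_self (β : ℝ) {ξ : Fin 3 → ℝ} (hξ : ξ ≠ 0) (v : Fin 3 → ℝ) :
    v ⬝ᵥ (Ftilde β ξ).mulVec v = Lb' β (enorm3 ξ) * ((v ⬝ᵥ ξ) ^ 2 / enorm3 ξ ^ 2) +
      Lb β (enorm3 ξ) / enorm3 ξ * (v ⬝ᵥ v - (v ⬝ᵥ ξ) ^ 2 / enorm3 ξ ^ 2) := by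
  simp only [dotProduct, Matrix.mulVec, Ftilde_apply β hξ, Fin.sum_univ_three, Matrix.one_apply]
  simp
  ring

theorem dotProduct_Ftilde_mulVec_self_pos {β : ℝ} (hβ : 0 < β) (ξ : Fin 3 → ℝ)
    {v : Fin 3 → ℝ} (hv : v ≠ 0) : 0 < v ⬝ᵥ (Ftilde β ξ).mulVec v := by
  have hvv : 0 < v ⬝ᵥ v :=
    lt_of_le_of_ne (Finset.sum_nonneg fun _ _ => mul_self_nonneg _) (Ne.symm (mt dotProduct_self_eq_zero.1 hv))
  by_cases hξ : ξ = 0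
  · simp only [Ftilde, if_pos hξ, Matrix.smul_mulVec, Matrix.one_mulVec, dotProduct_smul,
      smul_eq_mul]
    positivity
  have hr := enorm3_pos hξ
  rw [dotProduct_Ftilde_mulVec_self β hξ]
  have hp : (v ⬝ᵥ ξ) ^ 2 / enorm3 ξ ^ 2 ≤ v ⬝ᵥ v := by
    rw [div_le_iff₀ (by positivity), enorm3_sq]
    have := Finset.sum_mul_sq_le_sq_mul_sq Finset.univ v ξ
    simpa only [dotProduct, ← pow_two] using this
  have hp0 : 0 ≤ (v ⬝ᵥ ξ) ^ 2 / enorm3 ξ ^ 2 := by positivity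
  have hA := Lb'_pos hβ hr
  have hB := Lb_div_pos hβ hr
  rcases hp0.eq_or_lt with h | h
  · rw [← h]; nlinarith [mul_pos hB hvv]
  · exact add_pos_of_pos_of_nonneg (mul_pos hA h) (mul_nonneg hB.le (sub_nonneg.2 hp))

theorem abs_Ftilde_apply_le {β : ℝ} (hβ : 0 < β) (ξ : Fin 3 → ℝ) (i j : Fin 3) :
    |Ftilde β ξ i j| ≤ 2 * β := by
  have hone : |(1 : Matrix (Fin 3) (Fin 3) ℝ) i j| ≤ 1 := by
    rw [Matrix.one_apply]; split_ifs <;> simp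
  by_cases hξ : ξ = 0
  · simp only [Ftilde, if_pos hξ, Matrix.smul_apply, smul_eq_mul, abs_mul]
    rw [abs_of_pos (by positivity : 0 < β / 3)]
    nlinarith
  have hr := enorm3_pos hξ
  have hle : ∀ k, |ξ k| ≤ enorm3 ξ := fun k => by
    refine abs_le_of_sq_le_sq ?_ hr.le
    rw [enorm3_sq]
    exact Finset.single_le_sum (f := fun k => ξ k ^ 2) (fun _ _ => sq_nonneg _)
      (Finset.mem_univ k)
  have hij : |ξ i * ξ j / enorm3 ξ ^ 2| ≤ 1 := by
    rw [abs_div, abs_of_pos (by positivity : 0 < enorm3 ξ ^ 2), div_le_one (by positivity),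
      abs_mul, pow_two]
    exact mul_le_mul (hle i) (hle j) (abs_nonneg _) hr.le
  have hA := Lb'_pos hβ hr
  have hB := Lb_div_pos hβ hr
  have hA' := Lb'_le hβ hr
  have hB' := Lb_div_le hβ hr
  rw [Ftilde_apply β hξ]
  refine (abs_add_le _ _).trans ?_
  rw [abs_mul, abs_mul, two_mul]
  have hAB : |Lb' β (enorm3 ξ) - Lb β (enorm3 ξ) / enorm3 ξ| ≤ β :=
    abs_le.2 ⟨by linarith, by linarith⟩
  exact add_le_add ((mul_le_of_le_one_right (abs_nonneg _) hij).trans hAB)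
    ((mul_le_of_le_one_right (abs_nonneg _) hone).trans (by rwa [abs_of_pos hB]))

theorem abs_dotProduct_mulVec_le {C : ℝ} {M : Matrix (Fin 3) (Fin 3) ℝ}
    (hM : ∀ i j, |M i j| ≤ C) (q v : Fin 3 → ℝ) :
    |q ⬝ᵥ M.mulVec v| ≤ ∑ i, ∑ j, |q i| * (C * |v j|) := by
  simp only [dotProduct, Matrix.mulVec, Finset.mul_sum]
  refine (Finset.abs_sum_le_sum_abs _ _).trans (Finset.sum_le_sum fun i _ => ?_)
  refine (Finset.abs_sum_le_sum_abs _ _).trans (Finset.sum_le_sum fun j _ => ?_)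
  rw [abs_mul, abs_mul]
  gcongr
  exact hM i j

theorem measurable_Ftilde_apply (β : ℝ) (i j : Fin 3) :
    Measurable fun ξ : Fin 3 → ℝ => Ftilde β ξ i j := by
  have hn : Measurable enorm3 := by unfold enorm3; fun_prop
  have hL : Measurable (Lb β) := by
    unfold Lb coth
    exact Measurable.ite (measurableSet_singleton 0) measurable_const (by fun_prop)
  have hL' : Measurable (Lb' β) := by unfold Lb'; fun_prop
  have h : (fun ξ : Fin 3 → ℝ => Ftilde β ξ i j) = fun ξ => if ξ = 0
      then (β / 3) * (1 : Matrix (Fin 3) (Fin 3) ℝ) i j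
      else (Lb' β (enorm3 ξ) / (enorm3 ξ) ^ 2 - Lb β (enorm3 ξ) / (enorm3 ξ) ^ 3) * (ξ i * ξ j)
        + (Lb β (enorm3 ξ) / enorm3 ξ) * (1 : Matrix (Fin 3) (Fin 3) ℝ) i j := by
    funext ξ
    unfold Ftilde
    split_ifs <;> simp
  rw [h]
  exact Measurable.ite (measurableSet_singleton 0) measurable_const (by fun_prop)

theorem measurable_dotProduct_Ftilde_mulVec {α : Type*} [MeasurableSpace α] (β : ℝ)
    (q : Fin 3 → ℝ) {ξ v : α → Fin 3 → ℝ} (hξ : Measurable ξ) (hv : Measurable v) :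
    Measurable fun p => q ⬝ᵥ (Ftilde β (ξ p)).mulVec (v p) := by
  have hF : ∀ i j, Measurable fun p => Ftilde β (ξ p) i j := fun i j =>
    (measurable_Ftilde_apply β i j).comp hξ
  simp only [dotProduct, Matrix.mulVec]
  fun_prop

theorem measurable_matrix_mulVec (G : Matrix (Fin 3) (Fin 3) ℝ) :
    Measurable fun x : Fin 3 → ℝ => G.mulVec x :=
  (Continuous.matrix_mulVec continuous_const continuous_id).measurable

theorem integrableOn_dotProduct_Ftilde_mulVec {β : ℝ} (hβ : 0 < β)
    (G : Matrix (Fin 3) (Fin 3) ℝ) {Ω : Set (Fin 3 → ℝ)} (hΩ : volume Ω < ⊤)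
    (q y v : Fin 3 → ℝ) :
    IntegrableOn (fun x => q ⬝ᵥ (Ftilde β (G.mulVec (x - y))).mulVec v) Ω := by
  refine IntegrableOn.of_bound hΩ (Measurable.aestronglyMeasurable ?_) _
    (ae_of_all _ fun x => abs_dotProduct_mulVec_le (abs_Ftilde_apply_le hβ _) q v)
  exact measurable_dotProduct_Ftilde_mulVec β q
    ((measurable_matrix_mulVec G).comp (measurable_id.sub_const y)) measurable_const

theorem exists_integral_dotProduct_Ftilde_mulVec_ne_zero {β : ℝ} (hβ : 0 < β)
    (G : Matrix (Fin 3) (Fin 3) ℝ) {Ω : Set (Fin 3 → ℝ)} (hΩ : volume Ω < ⊤)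
    (hΩpos : 0 < volume Ω) {R : Fin 3 → Fin 3 → ℝ}
    (hR : Submodule.span ℝ (Set.range R) = ⊤) (y : Fin 3 → ℝ) {v : Fin 3 → ℝ} (hv : v ≠ 0) :
    ∃ i, ∫ x in Ω, R i ⬝ᵥ (Ftilde β (G.mulVec (x - y))).mulVec v ≠ 0 := by
  by_contra! h
  obtain ⟨c, hc⟩ := (Submodule.mem_span_range_iff_exists_fun ℝ).1
    (hR ▸ Submodule.mem_top : v ∈ Submodule.span ℝ (Set.range R))
  have hpos : 0 < ∫ x in Ω, v ⬝ᵥ (Ftilde β (G.mulVec (x - y))).mulVec v := by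
    rw [integral_pos_iff_support_of_nonneg
      (fun x => (dotProduct_Ftilde_mulVec_self_pos hβ _ hv).le)
      (integrableOn_dotProduct_Ftilde_mulVec hβ G hΩ v y v),
      Function.support_eq_univ fun x => (dotProduct_Ftilde_mulVec_self_pos hβ _ hv).ne',
      Measure.restrict_apply_univ]
    exact hΩpos
  have hzero : ∫ x in Ω, v ⬝ᵥ (Ftilde β (G.mulVec (x - y))).mulVec v = 0 := by
    have hsum : ∀ x, v ⬝ᵥ (Ftilde β (G.mulVec (x - y))).mulVec v =
        ∑ i, c i * (R i ⬝ᵥ (Ftilde β (G.mulVec (x - y))).mulVec v) := fun x => by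
      conv_lhs => enter [1]; rw [← hc]
      rw [sum_dotProduct]
      simp only [smul_dotProduct, smul_eq_mul]
    simp only [hsum]
    rw [integral_finsetSum _ fun i _ =>
      (integrableOn_dotProduct_Ftilde_mulVec hβ G hΩ (R i) y v).const_mul (c i)]
    simp only [integral_const_mul, h, mul_zero, Finset.sum_const_zero]
  exact hpos.ne' hzero

/-- Regularity of the MPI forward operator: for `β, μ₀, m₀ > 0`, `G` invertible, a compact
interval `[a,b]` of positive length, `Ω ⊂ ℝ³` bounded measurable with positive measure, coil
sensitivities `R₁, R₂, R₃` spanning `ℝ³`, a continuously differentiable trajectory `xs` with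
derivative `xs'`, and an interior point `t*` with `xs'(t*) ≠ 0`, the signal `u` defined by
`u_i(t) = −μ₀ m₀ ∫_Ω R_iᵀ F̃(G(x − xs(t))) G xs'(t) dx` satisfies `∫_[a,b] ‖u(t)‖² dt > 0`. -/
theorem mpi_forward_operator_regularity (β μ₀ m₀ : ℝ) (hβ : 0 < β) (hμ₀ : 0 < μ₀)
    (hm₀ : 0 < m₀) (G : Matrix (Fin 3) (Fin 3) ℝ) (hG : IsUnit G.det)
    (a b : ℝ) (hab : a < b)
    (Ω : Set (Fin 3 → ℝ)) (hΩb : Bornology.IsBounded Ω) (hΩm : MeasurableSet Ω)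
    (hΩpos : 0 < volume Ω)
    (R : Fin 3 → Fin 3 → ℝ) (hR : Submodule.span ℝ (Set.range R) = ⊤)
    (xs xs' : ℝ → Fin 3 → ℝ)
    (hderiv : ∀ t ∈ Set.Icc a b, HasDerivWithinAt xs (xs' t) (Set.Icc a b) t)
    (hcont : ContinuousOn xs' (Set.Icc a b))
    (tstar : ℝ) (htstar : tstar ∈ Set.Ioo a b) (hxs : xs' tstar ≠ 0) :
    0 < ∫ t in Set.Icc a b, ∑ i : Fin 3,
      (-(μ₀ * m₀) *
        ∫ x in Ω, R i ⬝ᵥ (Ftilde β (G.mulVec (x - xs t))).mulVec (G.mulVec (xs' t))) ^ 2 := by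
  classical
  have hΩ : volume Ω < ⊤ := hΩb.measure_lt_top
  have hxsc : ContinuousOn xs (Set.Icc a b) := fun t ht => (hderiv t ht).continuousWithinAt
  have hext : ∀ f : ℝ → Fin 3 → ℝ, ContinuousOn f (Set.Icc a b) →
      ∃ g, Measurable g ∧ Set.EqOn f g (Set.Icc a b) := fun f hf =>
    ⟨(Set.Icc a b).piecewise f 0, hf.measurable_piecewise continuousOn_const measurableSet_Icc,
      (Set.piecewise_eqOn _ _ _).symm⟩
  obtain ⟨y, hy, hxy⟩ := hext xs hxsc
  obtain ⟨w, hw, hxw⟩ := hext xs' hcont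
  have hGc : ContinuousOn (fun t => G.mulVec (xs' t)) (Set.Icc a b) :=
    (Continuous.matrix_mulVec continuous_const continuous_id).comp_continuousOn hcont
  have hmeas : AEStronglyMeasurable (fun t => ∑ i : Fin 3, (-(μ₀ * m₀) *
      ∫ x in Ω, R i ⬝ᵥ (Ftilde β (G.mulVec (x - xs t))).mulVec (G.mulVec (xs' t))) ^ 2)
      (volume.restrict (Set.Icc a b)) := by
    have hint : ∀ i, Measurable fun t =>
        ∫ x in Ω, R i ⬝ᵥ (Ftilde β (G.mulVec (x - y t))).mulVec (G.mulVec (w t)) := fun i =>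
      (StronglyMeasurable.integral_prod_right' (Measurable.stronglyMeasurable
        (measurable_dotProduct_Ftilde_mulVec β (R i)
          ((measurable_matrix_mulVec G).comp (measurable_snd.sub (hy.comp measurable_fst)))
          ((measurable_matrix_mulVec G).comp (hw.comp measurable_fst))))).measurable
    refine AEStronglyMeasurable.congr (f := fun t => ∑ i : Fin 3, (-(μ₀ * m₀) *
      ∫ x in Ω, R i ⬝ᵥ (Ftilde β (G.mulVec (x - y t))).mulVec (G.mulVec (w t))) ^ 2)
      (Measurable.aestronglyMeasurable (by fun_prop)) ?_
    filter_upwards [ae_restrict_mem measurableSet_Icc] with t ht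
    rw [hxy ht, hxw ht]
  have hbound : IntegrableOn (fun t => ∑ i : Fin 3, (|-(μ₀ * m₀)| *
      ((∑ j, ∑ k, |R i j| * (2 * β * |G.mulVec (xs' t) k|)) * volume.real Ω)) ^ 2)
      (Set.Icc a b) :=
    ContinuousOn.integrableOn_Icc (by fun_prop)
  have hfint := Integrable.mono' hbound hmeas (ae_of_all _ fun t => by
    rw [Real.norm_of_nonneg (Finset.sum_nonneg fun _ _ => sq_nonneg _)]
    refine Finset.sum_le_sum fun i _ => ?_
    rw [← sq_abs, abs_mul]
    gcongr
    rw [← Real.norm_eq_abs]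
    refine norm_setIntegral_le_of_norm_le_const hΩ fun x _ => ?_
    rw [Real.norm_eq_abs]
    exact abs_dotProduct_mulVec_le (abs_Ftilde_apply_le hβ _) (R i) _)
  rw [setIntegral_pos_iff_support_of_nonneg_ae
    (ae_of_all _ fun t => Finset.sum_nonneg fun _ _ => sq_nonneg _) hfint]
  have hnhds : ∀ᶠ t in 𝓝 tstar, xs' t ≠ 0 ∧ t ∈ Set.Icc a b :=
    have hIcc : Set.Icc a b ∈ 𝓝 tstar := Icc_mem_nhds htstar.1 htstar.2
    (((hcont.continuousAt hIcc).eventually_ne hxs).and hIcc)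
  refine Measure.measure_pos_of_mem_nhds volume (x := tstar) ?_
  filter_upwards [hnhds] with t ht
  refine ⟨?_, ht.2⟩
  have hv : G.mulVec (xs' t) ≠ 0 := fun h =>
    ht.1 (Matrix.eq_zero_of_mulVec_eq_zero hG.ne_zero h)
  obtain ⟨i, hi⟩ :=
    exists_integral_dotProduct_Ftilde_mulVec_ne_zero hβ G hΩ hΩpos hR (xs t) hv
  have hui := mul_ne_zero (neg_ne_zero.2 (mul_pos hμ₀ hm₀).ne') hi
  refine ne_of_gt (Finset.sum_pos' (fun _ _ => sq_nonneg _) ⟨i, Finset.mem_univ i, ?_⟩)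
  exact sq_pos_of_ne_zero hui
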